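/- Let p be a prime number and let A be a (possibly noncommutative) ring with no zero divisors which is a finitely generated module over its center Z, of rank p² over Z (i.e., the localization K ⊗_Z A at the fraction field K of Z has dimension p² as a K-vector space). Then for every element a ∈ A not belonging to Z, the natural embedding of the commutative subring Z[a] into the centralizer B_a of a induces an isomorphism between the field of fractions of Z[a] and the field of fractions of B_a. Equivalently, inside the division ring K ⊗_Z A, every element of B_a can be written as a quotient of two elements of Z[a]. -/

import Mathlib

theorem aux_finrank_dvd (K D : Type*) [Field K] [Ring D] [IsDomain D] [Algebra K D]
    [FiniteDimensional K D] (S : Subalgebra K D) :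
    Module.finrank K S ∣ Module.finrank K D := by
  letI : DivisionRing S := divisionRingOfFiniteDimensional K S
  exact Module.finrank_dvd_finrank_right K S D

theorem aux_mem_adjoin (p : ℕ) (hp : p.Prime) (K D : Type*) [Field K] [Ring D] [IsDomain D]
    [Algebra K D] [FiniteDimensional K D] (hr : Module.finrank K D = p ^ 2)
    (x c : D) (hc : x * c ≠ c * x) (y : D) (hy : x * y = y * x) :
    y ∈ Algebra.adjoin K {x} := by
  set L := Algebra.adjoin K {x} with hL
  set C := Subalgebra.centralizer K ({x} : Set D) with hC
  have hxL : x ∈ L := Algebra.subset_adjoin rfl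
  have hLC : L ≤ C := by
    refine Algebra.adjoin_le ?_
    rintro z rfl
    exact Set.mem_centralizer_iff.2 (by rintro w rfl; rfl)
  have hyC : y ∈ C := by
    simpa [hC, Subalgebra.mem_centralizer_iff] using hy
  have hdL := aux_finrank_dvd K D L
  have hdC := aux_finrank_dvd K D C
  rw [hr] at hdL hdC
  have hL1 : Module.finrank K L ≠ 1 := by
    intro h
    have := Subalgebra.bot_eq_top_of_finrank_eq_one h
    have hx : (⟨x, hxL⟩ : L) ∈ (⊥ : Subalgebra K L) := this ▸ Algebra.mem_top
    obtain ⟨k, hk⟩ := Algebra.mem_bot.1 hx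
    have hk' : algebraMap K D k = x := congrArg Subtype.val hk
    exact hc (by rw [← hk']; exact Algebra.commutes k c)
  have hC2 : Module.finrank K C ≠ p ^ 2 := by
    intro h
    have h1 : C.toSubmodule = ⊤ := Submodule.eq_top_of_finrank_eq (h.trans hr.symm)
    have h2 : c ∈ C.toSubmodule := h1 ▸ Submodule.mem_top
    have h3 : c ∈ C := h2
    rw [hC, Subalgebra.mem_centralizer_iff] at h3
    exact hc (h3 x rfl)
  have hle : Module.finrank K C ≤ Module.finrank K L := by
    obtain ⟨i, hi, hi'⟩ := (Nat.dvd_prime_pow hp).1 hdL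
    obtain ⟨j, hj, hj'⟩ := (Nat.dvd_prime_pow hp).1 hdC
    have : i ≠ 0 := by rintro rfl; rw [pow_zero] at hi'; exact hL1 hi'
    have : j ≠ 2 := by rintro rfl; exact hC2 hj'
    rw [hi', hj']
    exact Nat.pow_le_pow_right hp.pos (by omega)
  have : L.toSubmodule = C.toSubmodule :=
    Submodule.eq_of_le_of_finrank_le (by exact hLC) hle
  exact (this ▸ hyC : y ∈ L.toSubmodule)

open TensorProduct nonZeroDivisors in
theorem aux_main (p : ℕ) (hp : p.Prime) (Z A K : Type*) [CommRing Z] [IsDomain Z] [Ring A]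
    [IsDomain A] [Algebra Z A] [Field K] [Algebra Z K] [IsFractionRing Z K] [Module.Finite Z A]
    (hinj : Function.Injective (algebraMap Z A))
    (hr : Module.finrank K (K ⊗[Z] A) = p ^ 2)
    (a c : A) (hc : a * c ≠ c * a) (b : A) (hb : a * b = b * a) :
    ∃ s : Z, s ≠ 0 ∧ s • b ∈ Algebra.adjoin Z {a} := by
  let ι : A →ₐ[Z] K ⊗[Z] A := Algebra.TensorProduct.includeRight
  have hreg : ∀ s : Z, s ≠ 0 → ∀ x : A, s • x = 0 → x = 0 := by
    intro s hs x hx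
    rw [Algebra.smul_def] at hx
    exact (mul_eq_zero.1 hx).resolve_left fun h => hs (hinj (by simpa using h))
  have hloc : IsLocalizedModule Z⁰ (TensorProduct.mk Z K A 1) := inferInstance
  have hι : Function.Injective ι := by
    rw [injective_iff_map_eq_zero]
    intro x hx
    obtain ⟨s, hs⟩ := (IsLocalizedModule.eq_zero_iff Z⁰ (TensorProduct.mk Z K A 1)).1
      (show TensorProduct.mk Z K A 1 x = 0 from hx)
    exact hreg s (nonZeroDivisors.ne_zero s.2) x hs
  have hsurj : ∀ d : K ⊗[Z] A, ∃ s : Z, s ≠ 0 ∧ ∃ x, s • d = ι x := by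
    intro d
    obtain ⟨⟨x, s⟩, hs⟩ := IsLocalizedModule.surj Z⁰ (TensorProduct.mk Z K A 1) d
    exact ⟨s, nonZeroDivisors.ne_zero s.2, x, hs⟩
  have : Nontrivial (K ⊗[Z] A) := hι.nontrivial
  have hcan : ∀ s : Z, s ≠ 0 → ∀ d : K ⊗[Z] A, s • d = 0 → d = 0 := by
    intro s hs d hd
    rw [← algebraMap_smul K s d, smul_eq_zero] at hd
    exact hd.resolve_left (by simpa using hs)
  have : NoZeroDivisors (K ⊗[Z] A) := by
    refine ⟨fun {d e} hde => ?_⟩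
    obtain ⟨s, hs, x, hx⟩ := hsurj d
    obtain ⟨t, ht, y, hy⟩ := hsurj e
    have h : ι (x * y) = 0 := by
      rw [map_mul, ← hx, ← hy, smul_mul_smul_comm, hde, smul_zero]
    rw [map_eq_zero_iff ι hι, mul_eq_zero] at h
    rcases h with h | h
    · left; exact hcan s hs d (by rw [hx, h, map_zero])
    · right; exact hcan t ht e (by rw [hy, h, map_zero])
  have : IsDomain (K ⊗[Z] A) := NoZeroDivisors.to_isDomain _
  have hmem := aux_mem_adjoin p hp K (K ⊗[Z] A) hr (ι a) (ι c)
    (by rw [← map_mul, ← map_mul]; exact fun h => hc (hι h)) (ι b)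
    (by rw [← map_mul, ← map_mul, hb])
  have key : ∀ y ∈ Algebra.adjoin K {ι a},
      ∃ s : Z, s ≠ 0 ∧ ∃ u ∈ Algebra.adjoin Z {a}, s • y = ι u := by
    intro y hy
    induction hy using Algebra.adjoin_induction with
    | mem x hx =>
      rw [Set.mem_singleton_iff] at hx
      exact ⟨1, one_ne_zero, a, Algebra.subset_adjoin rfl, by rw [hx, one_smul]⟩
    | algebraMap r =>
      obtain ⟨⟨n, s⟩, hs⟩ := IsLocalization.surj Z⁰ r
      refine ⟨s, nonZeroDivisors.ne_zero s.2, algebraMap Z A n, Subalgebra.algebraMap_mem _ _, ?_⟩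
      simp only at hs
      rw [AlgHom.commutes, IsScalarTower.algebraMap_apply Z K (K ⊗[Z] A) n, ← hs, mul_comm r,
        map_mul, ← algebraMap_smul K (s : Z), Algebra.smul_def]
    | add x y _ _ hx hy =>
      obtain ⟨s, hs, u, hu, h⟩ := hx
      obtain ⟨t, ht, v, hv, h'⟩ := hy
      refine ⟨s * t, mul_ne_zero hs ht, t • u + s • v,
        add_mem (Subalgebra.smul_mem _ hu t) (Subalgebra.smul_mem _ hv s), ?_⟩
      rw [map_add, map_smul, map_smul, ← h, ← h', smul_add, mul_smul, mul_smul, smul_comm s t x]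
    | mul x y _ _ hx hy =>
      obtain ⟨s, hs, u, hu, h⟩ := hx
      obtain ⟨t, ht, v, hv, h'⟩ := hy
      refine ⟨s * t, mul_ne_zero hs ht, u * v, mul_mem hu hv, ?_⟩
      rw [map_mul, ← h, ← h', smul_mul_smul_comm]
  obtain ⟨s, hs, u, hu, h⟩ := key _ hmem
  refine ⟨s, hs, ?_⟩
  rw [← map_smul] at h
  rwa [hι h]

set_option synthInstance.maxHeartbeats 1000000 in
/-- Let `p` be a prime and `A` a domain which is a finitely generated module over its
center `Z`, of rank `p ^ 2` over `Z` (i.e. `K ⊗[Z] A` has dimension `p ^ 2` over the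
fraction field `K` of `Z`).  Then for every `a ∉ Z`, the embedding `Z[a] ⊆ B_a` of the
subring generated by `Z` and `a` into the centralizer of `a` induces an isomorphism of
fraction fields; equivalently, every element of the centralizer is a quotient of two
elements of `Z[a]`. -/
theorem centralizer_fractionField_eq_of_rank_p_sq
    (p : ℕ) (hp : p.Prime) (A : Type*) [Ring A] [IsDomain A]
    [Module.Finite (Subring.center A) A]
    (hrank : Module.finrank (FractionRing (Subring.center A))
      (TensorProduct (Subring.center A) (FractionRing (Subring.center A)) A) = p ^ 2)
    (a : A) (ha : a ∉ Subring.center A) :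
    ∀ b ∈ Subring.centralizer ({a} : Set A),
      ∃ u ∈ Subring.closure ((Subring.center A : Set A) ∪ {a}),
        ∃ v ∈ Subring.closure ((Subring.center A : Set A) ∪ {a}),
          v ≠ 0 ∧ b * v = u := by
  intro b hb
  have hb' : a * b = b * a := Subring.mem_centralizer_iff.1 hb a rfl
  have hc : ∃ c, a * c ≠ c * a := by
    by_contra! h
    exact ha (Subring.mem_center_iff.2 fun g => (h g).symm)
  obtain ⟨c, hc⟩ := hc
  obtain ⟨s, hs, h⟩ := aux_main p hp (Subring.center A) A (FractionRing (Subring.center A))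
    Subtype.val_injective hrank a c hc b hb'
  have hsb : s • b = b * (s : A) := (Subring.mem_center_iff.1 s.2 b).symm
  refine ⟨b * s, ?_, s, Subring.subset_closure (Or.inl s.2), by simpa using hs, rfl⟩
  rw [hsb] at h
  generalize b * (s : A) = w at h
  induction h using Algebra.adjoin_induction with
  | mem x hx => exact Subring.subset_closure (Or.inr hx)
  | algebraMap r => exact Subring.subset_closure (Or.inl r.2)
  | add x y _ _ hx hy => exact add_mem hx hy
  | mul x y _ _ hx hy => exact mul_mem hx hy
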